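/- Let 0 < α < n, 0 < β < 1 with α + β < n, 1 < p < n/(α+β) and 1/q = 1/p − (α+β)/n. Let Ω be homogeneous of degree zero, have mean value zero on S^{n−1}, and be a Lipschitz function. Then for every η with 1 < η < n/(α+β) there exists a constant C, independent of f and b, such that for all b ∈ Lip_β(ℝ^n), all f ∈ L^p(ℝ^n), and all x ∈ ℝ^n: M^♯([b, T_{Ω,α}]f)(x) ≤ C ‖b‖_{Lip_β} [ ( M_{βη}(|T_{Ω,α} f|^η)(x) )^{1/η} + ( M_{αη+βη}(|f|^η)(x) )^{1/η} ]. -/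

import Mathlib

open MeasureTheory ENNReal Metric

noncomputable section

/-- The (closed) cube centered at `x` with side length `r`. -/
def cube {n : ℕ} (x : EuclideanSpace ℝ (Fin n)) (r : ℝ) : Set (EuclideanSpace ℝ (Fin n)) :=
  {y | ∀ i, |y i - x i| ≤ r / 2}

/-- The average `f_Q = |Q|⁻¹ ∫_Q f` of `f` over a set `Q`. -/
def setAvg {n : ℕ} (Q : Set (EuclideanSpace ℝ (Fin n))) (f : EuclideanSpace ℝ (Fin n) → ℝ) : ℝ :=
  (volume Q).toReal⁻¹ * ∫ y in Q, f y

/-- Slice norm of an `ℝ≥0∞`-valued function. -/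
def sliceNormE {n : ℕ} (p q t : ℝ) (g : EuclideanSpace ℝ (Fin n) → ℝ≥0∞) : ℝ≥0∞ :=
  (∫⁻ x, ((volume (cube x t))⁻¹ * ∫⁻ y in cube x t, g y ^ p) ^ (q / p)) ^ (1 / q)

/-- The slice space norm `‖f‖_{(E_p^q)_t}`. -/
def sliceNorm {n : ℕ} (p q t : ℝ) (f : EuclideanSpace ℝ (Fin n) → ℝ) : ℝ≥0∞ :=
  sliceNormE p q t fun y => ENNReal.ofReal |f y|

/-- Membership in the slice space `(E_p^q)_t(ℝⁿ)`. -/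
def MemSlice {n : ℕ} (p q t : ℝ) (f : EuclideanSpace ℝ (Fin n) → ℝ) : Prop :=
  Measurable f ∧ sliceNorm p q t f ≠ ∞

/-- The BMO seminorm, as a supremum over all cubes. -/
def bmoNorm {n : ℕ} (b : EuclideanSpace ℝ (Fin n) → ℝ) : ℝ≥0∞ :=
  ⨆ (x : EuclideanSpace ℝ (Fin n)) (r : ℝ) (_ : 0 < r),
    (volume (cube x r))⁻¹ * ∫⁻ y in cube x r, ENNReal.ofReal |b y - setAvg (cube x r) b|

/-- Membership in `BMO(ℝⁿ)`. -/
def MemBMO {n : ℕ} (b : EuclideanSpace ℝ (Fin n) → ℝ) : Prop :=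
  LocallyIntegrable b volume ∧ bmoNorm b ≠ ∞

/-- `Ω` is homogeneous of degree zero. -/
def HomogZero {n : ℕ} (Ω : EuclideanSpace ℝ (Fin n) → ℝ) : Prop :=
  ∀ lam : ℝ, 0 < lam → ∀ x : EuclideanSpace ℝ (Fin n), x ≠ 0 → Ω (lam • x) = Ω x

/-- `Ω` has mean value zero on the unit sphere. -/
def MeanZeroOnSphere {n : ℕ} (Ω : EuclideanSpace ℝ (Fin n) → ℝ) : Prop :=
  ∫ x : sphere (0 : EuclideanSpace ℝ (Fin n)) 1, Ω x
    ∂((volume : Measure (EuclideanSpace ℝ (Fin n))).toSphere) = 0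

/-- The fractional integral operator with rough kernel,
`T_{Ω,α} f (x) = ∫ Ω(x-y) |x-y|^{α-n} f(y) dy`. -/
def fracInt {n : ℕ} (Ω : EuclideanSpace ℝ (Fin n) → ℝ) (α : ℝ)
    (f : EuclideanSpace ℝ (Fin n) → ℝ) (x : EuclideanSpace ℝ (Fin n)) : ℝ :=
  ∫ y, Ω (x - y) * ‖x - y‖ ^ (α - n) * f y

/-- The commutator `[b, T_{Ω,α}] f = b ⬝ T_{Ω,α} f - T_{Ω,α}(b f)`. -/
def commutatorOp {n : ℕ} (Ω : EuclideanSpace ℝ (Fin n) → ℝ) (α : ℝ)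
    (b f : EuclideanSpace ℝ (Fin n) → ℝ) : EuclideanSpace ℝ (Fin n) → ℝ :=
  fun x => b x * fracInt Ω α f x - fracInt Ω α (fun y => b y * f y) x

/-- The fractional maximal operator `M_γ` (over cubes); `γ = 0` gives the
Hardy–Littlewood maximal operator. -/
def fracMax {n : ℕ} (γ : ℝ) (f : EuclideanSpace ℝ (Fin n) → ℝ)
    (x : EuclideanSpace ℝ (Fin n)) : ℝ≥0∞ :=
  ⨆ (z : EuclideanSpace ℝ (Fin n)) (r : ℝ) (_ : 0 < r) (_ : x ∈ cube z r),
    volume (cube z r) ^ (γ / n - 1) * ∫⁻ y in cube z r, ENNReal.ofReal |f y|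

/-- The Fefferman–Stein sharp maximal operator `M^♯`. -/
def sharpMax {n : ℕ} (f : EuclideanSpace ℝ (Fin n) → ℝ)
    (x : EuclideanSpace ℝ (Fin n)) : ℝ≥0∞ :=
  ⨆ (z : EuclideanSpace ℝ (Fin n)) (r : ℝ) (_ : 0 < r) (_ : x ∈ cube z r),
    (volume (cube z r))⁻¹ * ∫⁻ y in cube z r, ENNReal.ofReal |f y - setAvg (cube z r) f|

/-- The `L^p` norm. -/
def lpNorm {n : ℕ} (p : ℝ) (f : EuclideanSpace ℝ (Fin n) → ℝ) : ℝ≥0∞ :=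
  (∫⁻ x, ENNReal.ofReal |f x| ^ p) ^ (1 / p)

/-- The set of admissible Hölder–Lipschitz constants of order `β` for `b`. -/
def LipConstSet {n : ℕ} (β : ℝ) (b : EuclideanSpace ℝ (Fin n) → ℝ) : Set ℝ :=
  {C : ℝ | ∀ x y, |b x - b y| ≤ C * dist x y ^ β}

/-- Membership in the Lipschitz space `Lip_β(ℝⁿ)`. -/
def MemLip {n : ℕ} (β : ℝ) (b : EuclideanSpace ℝ (Fin n) → ℝ) : Prop :=
  (LipConstSet β b).Nonempty

/-- The `Lip_β` norm: the least admissible constant. -/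
def lipNorm {n : ℕ} (β : ℝ) (b : EuclideanSpace ℝ (Fin n) → ℝ) : ℝ :=
  sInf (LipConstSet β b)

lemma norm_le_of_mem_cube {n : ℕ} {c y : EuclideanSpace ℝ (Fin n)} {r : ℝ} (hr : 0 < r)
    (hy : y ∈ cube c r) : ‖y - c‖ ≤ n * r / 2 := by
  have h : ‖y - c‖ ^ 2 ≤ (n * r / 2) ^ 2 := by
    rw [EuclideanSpace.norm_sq_eq]
    calc ∑ i, ‖(y - c).ofLp i‖ ^ 2 ≤ ∑ _i : Fin n, (r / 2) ^ 2 := by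
          refine Finset.sum_le_sum fun i _ => ?_
          have := hy i
          simp only [PiLp.sub_apply, Real.norm_eq_abs]
          gcongr
      _ = n * (r / 2) ^ 2 := by simp
      _ ≤ (n * r / 2) ^ 2 := by
          have : (n : ℝ) ≤ (n : ℝ) ^ 2 := by exact_mod_cast Nat.le_self_pow two_ne_zero n
          nlinarith [sq_nonneg (r / 2)]
  exact le_of_sq_le_sq h (by positivity)

lemma mem_cube_of_norm_le {n : ℕ} {c y : EuclideanSpace ℝ (Fin n)} {r : ℝ}
    (h : ‖y - c‖ ≤ r / 2) : y ∈ cube c r := fun i => by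
  simpa using (PiLp.norm_apply_le (y - c) i).trans h

lemma cube_mono {n : ℕ} (c : EuclideanSpace ℝ (Fin n)) {r s : ℝ} (h : r ≤ s) :
    cube c r ⊆ cube c s := fun _ hy i => (hy i).trans (by linarith)

lemma measurableSet_cube {n : ℕ} (c : EuclideanSpace ℝ (Fin n)) (r : ℝ) :
    MeasurableSet (cube c r) := by
  have : cube c r = ⋂ i, {y : EuclideanSpace ℝ (Fin n) | |y i - c i| ≤ r / 2} := by
    ext; simp [cube]
  rw [this]
  exact MeasurableSet.iInter fun i => measurableSet_le (by fun_prop) measurable_const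

lemma volume_cube {n : ℕ} (c : EuclideanSpace ℝ (Fin n)) {r : ℝ} (hr : 0 < r) :
    volume (cube c r) = ENNReal.ofReal (r ^ (n : ℝ)) := by
  have h : cube c r = WithLp.ofLp ⁻¹'
      Set.Icc (fun i => c i - r / 2) (fun i => c i + r / 2) := by
    ext y
    simp only [cube, Set.mem_ofPred_eq, Set.mem_preimage, Set.mem_Icc, Pi.le_def, abs_le,
      ← forall_and]
    refine forall_congr' fun i => ?_
    constructor <;> rintro ⟨h1, h2⟩ <;> constructor <;> linarith
  rw [h, (PiLp.volume_preserving_ofLp (Fin n)).measure_preimage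
    measurableSet_Icc.nullMeasurableSet, Real.volume_Icc_pi]
  have : ∀ i : Fin n, c i + r / 2 - (c i - r / 2) = r := fun i => by ring
  simp [this, ENNReal.ofReal_pow hr.le]

lemma setLIntegral_cube_le {n : ℕ} {s : ℝ} (hs : 1 < s) {g : EuclideanSpace ℝ (Fin n) → ℝ}
    (hg : Measurable g) (c : EuclideanSpace ℝ (Fin n)) {t : ℝ} (ht : 0 < t) :
    ∫⁻ y in cube c t, ENNReal.ofReal |g y| ≤
      (∫⁻ y in cube c t, ENNReal.ofReal |g y| ^ s) ^ (1 / s) *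
        ENNReal.ofReal (t ^ (n - n / s)) := by
  have hs0 : 0 < s := by linarith
  have hpq : s.HolderConjugate (s.conjExponent) := Real.HolderConjugate.conjExponent hs
  have h := ENNReal.lintegral_mul_le_Lp_mul_Lq (volume.restrict (cube c t)) hpq
    (f := fun y => ENNReal.ofReal |g y|) (g := fun _ => 1)
    (by fun_prop) (by fun_prop)
  have h2 : 1 / s.conjExponent = 1 - 1 / s := by
    have := hpq.inv_add_inv_eq_one
    simp only [one_div]; linarith
  simp only [Pi.mul_apply, mul_one, ENNReal.one_rpow, lintegral_const, one_mul,
    Measure.restrict_apply_univ, volume_cube c ht, h2] at h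
  rw [ENNReal.ofReal_rpow_of_pos (by positivity), ← Real.rpow_mul ht.le] at h
  convert h using 4
  field_simp

lemma setLIntegral_cube_le_lpNorm {n : ℕ} {p : ℝ} (hp : 1 < p)
    {g : EuclideanSpace ℝ (Fin n) → ℝ}
    (hg : Measurable g) (c : EuclideanSpace ℝ (Fin n)) {t : ℝ} (ht : 0 < t) :
    ∫⁻ y in cube c t, ENNReal.ofReal |g y| ≤
      _root_.lpNorm p g * ENNReal.ofReal (t ^ (n - n / p)) := by
  refine (setLIntegral_cube_le hp hg c ht).trans ?_
  unfold _root_.lpNorm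
  gcongr
  · exact Measure.restrict_le_self

lemma setLIntegral_cube_le_fracMax {n : ℕ} (hn : 1 ≤ n) {η : ℝ} (hη : 1 < η) (γ : ℝ)
    {g : EuclideanSpace ℝ (Fin n) → ℝ}
    (hg : Measurable g) {c x : EuclideanSpace ℝ (Fin n)} {t : ℝ} (ht : 0 < t)
    (hx : x ∈ cube c t) :
    ∫⁻ y in cube c t, ENNReal.ofReal |g y| ≤
      (fracMax (γ * η) (fun y => |g y| ^ η) x) ^ (1 / η) * ENNReal.ofReal (t ^ (n - γ)) := by
  have hη0 : 0 < η := by linarith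
  have hn0 : (0 : ℝ) < n := by exact_mod_cast hn
  refine (setLIntegral_cube_le hη hg c ht).trans ?_
  have h1 : ENNReal.ofReal (t ^ (γ * η - n)) * ∫⁻ y in cube c t, ENNReal.ofReal |g y| ^ η ≤
      fracMax (γ * η) (fun y => |g y| ^ η) x := by
    refine le_trans (le_of_eq ?_) (le_iSup₂_of_le c t (le_iSup₂_of_le ht hx le_rfl))
    rw [volume_cube c ht, ENNReal.ofReal_rpow_of_pos (by positivity), ← Real.rpow_mul ht.le]
    congr 1
    · congr 2; field_simp
    · refine lintegral_congr fun y => ?_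
      simp only [abs_of_nonneg (Real.rpow_nonneg (abs_nonneg (g y)) η)]
      exact ENNReal.ofReal_rpow_of_nonneg (abs_nonneg _) hη0.le
  have h2 := ENNReal.rpow_le_rpow h1 (one_div_pos.2 hη0).le
  rw [ENNReal.mul_rpow_of_nonneg _ _ (one_div_pos.2 hη0).le,
    ENNReal.ofReal_rpow_of_pos (by positivity), ← Real.rpow_mul ht.le] at h2
  calc _ = (ENNReal.ofReal (t ^ ((γ * η - n) * (1 / η))) *
        (∫⁻ y in cube c t, ENNReal.ofReal |g y| ^ η) ^ (1 / η)) *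
          ENNReal.ofReal (t ^ (n - γ)) := by
        rw [mul_comm (ENNReal.ofReal _), mul_assoc, ← ENNReal.ofReal_mul (by positivity),
          ← Real.rpow_add ht]
        congr 3
        field_simp
        ring
    _ ≤ _ := by gcongr

/-- Oscillation around the mean is controlled by oscillation around any constant. -/
lemma oscillation_le {n : ℕ} {F : EuclideanSpace ℝ (Fin n) → ℝ} (hF : Measurable F)
    (c : EuclideanSpace ℝ (Fin n)) {r : ℝ} (hr : 0 < r) (a : ℝ) :
    (volume (cube c r))⁻¹ * ∫⁻ y in cube c r, ENNReal.ofReal |F y - setAvg (cube c r) F| ≤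
      2 * ((volume (cube c r))⁻¹ * ∫⁻ y in cube c r, ENNReal.ofReal |F y - a|) := by
  set Q := cube c r
  have hv : volume Q = ENNReal.ofReal (r ^ (n : ℝ)) := volume_cube c hr
  have hrn : 0 < r ^ (n : ℝ) := by positivity
  have hv0 : volume Q ≠ 0 := by rw [hv]; simpa using hrn
  have hvt : volume Q ≠ ∞ := by rw [hv]; exact ofReal_ne_top
  by_cases hI : ∫⁻ y in Q, ENNReal.ofReal |F y - a| = ∞
  · rw [hI, ENNReal.mul_top (ENNReal.inv_ne_zero.2 hvt), ENNReal.mul_top (by simp)]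
    exact le_top
  have : IsFiniteMeasure (volume.restrict Q) := ⟨by simpa using hvt.lt_top⟩
  have hint : Integrable (fun y => F y - a) (volume.restrict Q) := by
    refine ⟨(hF.sub_const a).aestronglyMeasurable, ?_⟩
    rw [HasFiniteIntegral]
    simp only [Real.enorm_eq_ofReal_abs]
    exact lt_top_iff_ne_top.2 hI
  have hvr : (volume Q).toReal ≠ 0 := ENNReal.toReal_ne_zero.2 ⟨hv0, hvt⟩
  have havg : setAvg Q F - a = (volume Q).toReal⁻¹ * ∫ y in Q, (F y - a) := by
    have h1 : ∫ y in Q, F y = (∫ y in Q, (F y - a)) + (volume Q).toReal * a := by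
      have h2 := integral_add hint (integrable_const (μ := volume.restrict Q) a)
      simp only [sub_add_cancel, integral_const, smul_eq_mul] at h2
      rw [h2]
      simp [measureReal_def]
    rw [setAvg, h1]
    field_simp
    ring
  have hbd : ENNReal.ofReal |a - setAvg Q F| ≤
      (volume Q)⁻¹ * ∫⁻ y in Q, ENNReal.ofReal |F y - a| := by
    rw [abs_sub_comm, havg, abs_mul, abs_of_nonneg (by positivity),
      ENNReal.ofReal_mul (by positivity), ENNReal.ofReal_inv_of_pos (by positivity),
      ENNReal.ofReal_toReal hvt, ← Real.enorm_eq_ofReal_abs]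
    gcongr
    refine (enorm_integral_le_lintegral_enorm _).trans (le_of_eq ?_)
    simp only [Real.enorm_eq_ofReal_abs]
  calc (volume Q)⁻¹ * ∫⁻ y in Q, ENNReal.ofReal |F y - setAvg Q F|
      ≤ (volume Q)⁻¹ * ∫⁻ y in Q, (ENNReal.ofReal |F y - a| +
          ENNReal.ofReal |a - setAvg Q F|) := by
        gcongr with y
        rw [← ENNReal.ofReal_add (abs_nonneg _) (abs_nonneg _)]
        exact ENNReal.ofReal_le_ofReal (abs_sub_le _ _ _)
    _ = ((volume Q)⁻¹ * ∫⁻ y in Q, ENNReal.ofReal |F y - a|) +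
          ENNReal.ofReal |a - setAvg Q F| := by
        rw [lintegral_add_right _ measurable_const, mul_add, lintegral_const,
          Measure.restrict_apply_univ, mul_comm (ENNReal.ofReal _), ← mul_assoc,
          ENNReal.inv_mul_cancel hv0 hvt, one_mul]
    _ ≤ _ := by rw [two_mul]; exact add_le_add le_rfl hbd

lemma tsum_two_pow_rpow_neg_le {δ : ℝ} (hδ : 0 < δ) :
    ∃ S > (0 : ℝ), ∑' k : ℕ, ENNReal.ofReal (((2 : ℝ) ^ k) ^ (-δ)) ≤ ENNReal.ofReal S := by
  have h1 : (2 : ℝ) ^ (-δ) < 1 := Real.rpow_lt_one_of_one_lt_of_neg one_lt_two (by linarith)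
  have h0 : (0 : ℝ) < 2 ^ (-δ) := by positivity
  have h : ∀ k : ℕ, ((2 : ℝ) ^ k) ^ (-δ) = ((2 : ℝ) ^ (-δ)) ^ k := fun k => by
    rw [← Real.rpow_natCast, ← Real.rpow_natCast, ← Real.rpow_mul two_pos.le,
      ← Real.rpow_mul two_pos.le, mul_comm]
  refine ⟨(1 - 2 ^ (-δ))⁻¹, inv_pos.2 (by linarith), ?_⟩
  simp only [h]
  rw [← ENNReal.ofReal_tsum_of_nonneg (fun k => by positivity)
    (summable_geometric_of_lt_one h0.le h1), tsum_geometric_of_lt_one h0.le h1]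

/-- Dyadic estimate of `∫ |z - c|⁻ˢ g(z) dz` away from `c` when the integrals of `g` over the
cubes centred at `c` grow slower than `tˢ`. -/
lemma lintegral_compl_closedBall_le (n : ℕ) {s δ : ℝ} (hs : 0 ≤ s) (hδ : 0 < δ) :
    ∃ C > (0 : ℝ), ∀ (c : EuclideanSpace ℝ (Fin n)) (ρ : ℝ), 0 < ρ →
      ∀ g : EuclideanSpace ℝ (Fin n) → ℝ≥0∞, Measurable g → ∀ A : ℝ≥0∞,
      (∀ t, ρ ≤ t → ∫⁻ z in cube c t, g z ≤ A * ENNReal.ofReal (t ^ (s - δ))) →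
      ∫⁻ z in (closedBall c ρ)ᶜ, ENNReal.ofReal (‖z - c‖ ^ (-s)) * g z ≤
        ENNReal.ofReal (C * ρ ^ (-δ)) * A := by
  obtain ⟨S, hS, hsum⟩ := tsum_two_pow_rpow_neg_le hδ
  refine ⟨4 ^ (s - δ) * S, by positivity, fun c ρ hρ g hg A hA => ?_⟩
  have hpt : ∀ z ∈ (closedBall c ρ)ᶜ, ENNReal.ofReal (‖z - c‖ ^ (-s)) * g z ≤
      ∑' k : ℕ, (cube c (2 ^ k * (4 * ρ))).indicator
        (fun z => ENNReal.ofReal ((2 ^ k * ρ) ^ (-s)) * g z) z := by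
    intro z hz
    have hz' : ρ < ‖z - c‖ := by simpa [dist_eq_norm] using hz
    obtain ⟨k, hk1, hk2⟩ := exists_nat_pow_near (x := ‖z - c‖ / ρ) (y := (2 : ℝ))
      ((one_le_div hρ).2 hz'.le) one_lt_two
    rw [le_div_iff₀ hρ] at hk1
    rw [div_lt_iff₀ hρ] at hk2
    refine le_trans ?_ (ENNReal.le_tsum k)
    rw [Set.indicator_of_mem]
    · gcongr ?_ * _
      exact ENNReal.ofReal_le_ofReal
        (Real.rpow_le_rpow_of_nonpos (by positivity) hk1 (by linarith))
    · apply mem_cube_of_norm_le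
      rw [pow_succ] at hk2
      linarith
  calc _ ≤ ∫⁻ z in (closedBall c ρ)ᶜ, ∑' k : ℕ, (cube c (2 ^ k * (4 * ρ))).indicator
        (fun z => ENNReal.ofReal ((2 ^ k * ρ) ^ (-s)) * g z) z :=
        setLIntegral_mono' measurableSet_closedBall.compl hpt
    _ ≤ ∫⁻ z, ∑' k : ℕ, (cube c (2 ^ k * (4 * ρ))).indicator
        (fun z => ENNReal.ofReal ((2 ^ k * ρ) ^ (-s)) * g z) z := setLIntegral_le_lintegral _ _
    _ = ∑' k : ℕ, ENNReal.ofReal ((2 ^ k * ρ) ^ (-s)) *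
          ∫⁻ z in cube c (2 ^ k * (4 * ρ)), g z := by
        rw [lintegral_tsum fun k =>
          ((hg.const_mul _).indicator (measurableSet_cube _ _)).aemeasurable]
        refine tsum_congr fun k => ?_
        rw [lintegral_indicator (measurableSet_cube _ _), lintegral_const_mul _ hg]
    _ ≤ ∑' k : ℕ, (A * ENNReal.ofReal (4 ^ (s - δ) * ρ ^ (-δ))) *
          ENNReal.ofReal (((2 : ℝ) ^ k) ^ (-δ)) := by
        refine ENNReal.tsum_le_tsum fun k => ?_
        have h2k : (1 : ℝ) ≤ 2 ^ k := one_le_pow₀ one_le_two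
        refine (mul_le_mul_right (hA (2 ^ k * (4 * ρ)) (by nlinarith)) _).trans (le_of_eq ?_)
        rw [mul_left_comm, mul_assoc, ← ENNReal.ofReal_mul (by positivity),
          ← ENNReal.ofReal_mul (by positivity)]
        congr 2
        rw [Real.mul_rpow (by positivity) (by positivity),
          Real.mul_rpow (by positivity) (by positivity),
          Real.mul_rpow (by positivity) (by positivity)]
        have e1 : ((2 : ℝ) ^ k) ^ (-δ) = ((2 : ℝ) ^ k) ^ (-s) * ((2 : ℝ) ^ k) ^ (s - δ) := by
          rw [← Real.rpow_add (by positivity)]; ring_nf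
        have e2 : ρ ^ (-δ) = ρ ^ (-s) * ρ ^ (s - δ) := by
          rw [← Real.rpow_add (by positivity)]; ring_nf
        rw [e1, e2]; ring
    _ ≤ (A * ENNReal.ofReal (4 ^ (s - δ) * ρ ^ (-δ))) * ENNReal.ofReal S := by
        rw [ENNReal.tsum_mul_left]; gcongr
    _ = _ := by
        rw [mul_assoc, ← ENNReal.ofReal_mul (by positivity), mul_comm]
        ring_nf

lemma lintegral_closedBall_norm_rpow_le {n : ℕ} {α : ℝ} (hα : 0 < α) (hαn : α < n) :
    ∃ C > (0 : ℝ), ∀ (z : EuclideanSpace ℝ (Fin n)) (R : ℝ), 0 < R →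
      ∫⁻ y in closedBall z R, ENNReal.ofReal (‖y - z‖ ^ (α - n)) ≤
        ENNReal.ofReal (C * R ^ α) := by
  obtain ⟨S, hS, hsum⟩ := tsum_two_pow_rpow_neg_le hα
  refine ⟨2 ^ (n - α) * 2 ^ (n : ℝ) * S, by positivity, fun z R hR => ?_⟩
  have hpt : ∀ y ∈ closedBall z R, ENNReal.ofReal (‖y - z‖ ^ (α - n)) ≤
      ∑' k : ℕ, (cube z (2 * (R / 2 ^ k))).indicator
        (fun _ => ENNReal.ofReal ((R / 2 ^ (k + 1)) ^ (α - n))) y := by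
    intro y hy
    rcases eq_or_ne y z with rfl | hne
    · rw [sub_self, norm_zero, Real.zero_rpow (by linarith), ENNReal.ofReal_zero]
      exact zero_le
    have hy' : ‖y - z‖ ≤ R := by simpa [dist_eq_norm] using hy
    have hpos : 0 < ‖y - z‖ := norm_pos_iff.2 (sub_ne_zero.2 hne)
    obtain ⟨k, hk1, hk2⟩ := exists_nat_pow_near (x := R / ‖y - z‖) (y := (2 : ℝ))
      ((one_le_div hpos).2 hy') one_lt_two
    rw [le_div_iff₀ hpos] at hk1
    rw [div_lt_iff₀ hpos] at hk2
    refine le_trans ?_ (ENNReal.le_tsum k)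
    rw [Set.indicator_of_mem]
    · refine ENNReal.ofReal_le_ofReal
        (Real.rpow_le_rpow_of_nonpos (by positivity) ?_ (by linarith))
      rw [div_le_iff₀ (by positivity)]
      linarith
    · apply mem_cube_of_norm_le
      rw [mul_div_cancel_left₀ _ two_ne_zero, le_div_iff₀ (by positivity)]
      linarith
  calc _ ≤ ∫⁻ y in closedBall z R, ∑' k : ℕ, (cube z (2 * (R / 2 ^ k))).indicator
        (fun _ => ENNReal.ofReal ((R / 2 ^ (k + 1)) ^ (α - n))) y :=
        setLIntegral_mono' measurableSet_closedBall hpt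
    _ ≤ ∫⁻ y, ∑' k : ℕ, (cube z (2 * (R / 2 ^ k))).indicator
        (fun _ => ENNReal.ofReal ((R / 2 ^ (k + 1)) ^ (α - n))) y :=
        setLIntegral_le_lintegral _ _
    _ = ∑' k : ℕ, ENNReal.ofReal ((R / 2 ^ (k + 1)) ^ (α - n)) *
          ENNReal.ofReal ((2 * (R / 2 ^ k)) ^ (n : ℝ)) := by
        rw [lintegral_tsum fun k =>
          (measurable_const.indicator (measurableSet_cube _ _)).aemeasurable]
        refine tsum_congr fun k => ?_
        rw [lintegral_indicator (measurableSet_cube _ _), lintegral_const,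
          Measure.restrict_apply_univ, volume_cube _ (by positivity)]
    _ = ∑' k : ℕ, ENNReal.ofReal (2 ^ (n - α) * 2 ^ (n : ℝ) * R ^ α) *
          ENNReal.ofReal (((2 : ℝ) ^ k) ^ (-α)) := by
        refine tsum_congr fun k => ?_
        rw [← ENNReal.ofReal_mul (by positivity), ← ENNReal.ofReal_mul (by positivity)]
        congr 1
        have e0 : R / 2 ^ (k + 1) = (R / 2 ^ k) * 2⁻¹ := by
          rw [pow_succ]; field_simp
        have e1 : ((2 : ℝ)⁻¹) ^ (α - n) = 2 ^ (n - α) := by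
          rw [Real.inv_rpow two_pos.le, ← Real.rpow_neg two_pos.le]; ring_nf
        have e2 : R ^ α * ((2 : ℝ) ^ k) ^ (-α) = (R / 2 ^ k) ^ (α - n) * (R / 2 ^ k) ^ (n : ℝ) := by
          rw [← Real.rpow_add (by positivity), sub_add_cancel,
            Real.div_rpow hR.le (by positivity), Real.rpow_neg (by positivity)]
          rfl
        rw [e0, Real.mul_rpow (by positivity) (by positivity),
          Real.mul_rpow (by positivity) (by positivity), e1, mul_assoc _ (R ^ α), e2]
        ring
    _ ≤ _ := by
        rw [ENNReal.tsum_mul_left]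
        refine (mul_le_mul_right hsum _).trans (le_of_eq ?_)
        rw [← ENNReal.ofReal_mul (by positivity)]
        ring_nf

section Kernel

/-- The convolution kernel `Ω(u) |u|^{α-n}` of `fracInt Ω α`. -/
def fracKernel {n : ℕ} (Ω : EuclideanSpace ℝ (Fin n) → ℝ) (α : ℝ)
    (u : EuclideanSpace ℝ (Fin n)) : ℝ := Ω u * ‖u‖ ^ (α - n)

variable {n : ℕ} {Ω : EuclideanSpace ℝ (Fin n) → ℝ} {α : ℝ}

lemma HomogZero.apply_normalize (hhom : HomogZero Ω) {u : EuclideanSpace ℝ (Fin n)}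
    (hu : u ≠ 0) : Ω (‖u‖⁻¹ • u) = Ω u :=
  hhom _ (inv_pos.2 (norm_pos_iff.2 hu)) u hu

lemma normalize_mem_sphere {u : EuclideanSpace ℝ (Fin n)} (hu : u ≠ 0) :
    ‖u‖⁻¹ • u ∈ sphere (0 : EuclideanSpace ℝ (Fin n)) 1 := by
  simp [norm_smul, hu]

lemma HomogZero.exists_bound (hhom : HomogZero Ω)
    {L : NNReal} (hlip : LipschitzOnWith L Ω (sphere (0 : EuclideanSpace ℝ (Fin n)) 1)) :
    ∃ M > (0 : ℝ), ∀ u, u ≠ 0 → |Ω u| ≤ M := by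
  obtain ⟨M, hM⟩ := (isCompact_sphere (0 : EuclideanSpace ℝ (Fin n)) 1).exists_bound_of_continuousOn
    hlip.continuousOn
  refine ⟨max M 1, by positivity, fun u hu => ?_⟩
  rw [← hhom.apply_normalize hu]
  exact (hM _ (normalize_mem_sphere hu)).trans (le_max_left _ _)

lemma HomogZero.measurable (hhom : HomogZero Ω)
    {L : NNReal} (hlip : LipschitzOnWith L Ω (sphere (0 : EuclideanSpace ℝ (Fin n)) 1)) :
    Measurable Ω := by
  have hc : ContinuousOn Ω {0}ᶜ := by
    have h : ContinuousOn (fun u : EuclideanSpace ℝ (Fin n) => Ω (‖u‖⁻¹ • u)) {0}ᶜ := by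
      refine hlip.continuousOn.comp ?_ fun u hu => normalize_mem_sphere hu
      exact (continuousOn_id.norm.inv₀ fun u hu => norm_ne_zero_iff.2 hu).smul continuousOn_id
    exact h.congr fun u hu => (hhom.apply_normalize hu).symm
  exact measurable_of_continuousOn_compl_singleton 0 hc

lemma HomogZero.measurable_fracKernel (hhom : HomogZero Ω)
    {L : NNReal} (hlip : LipschitzOnWith L Ω (sphere (0 : EuclideanSpace ℝ (Fin n)) 1)) :
    Measurable (fracKernel Ω α) :=
  (hhom.measurable hlip).mul (by fun_prop)

lemma abs_fracKernel_le (hαn : α < n) {M : ℝ} (hM : ∀ u, u ≠ 0 → |Ω u| ≤ M)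
    (u : EuclideanSpace ℝ (Fin n)) : |fracKernel Ω α u| ≤ M * ‖u‖ ^ (α - n) := by
  rcases eq_or_ne u 0 with rfl | hu
  · simp [fracKernel, Real.zero_rpow (sub_neg.2 hαn).ne]
  · rw [fracKernel, abs_mul, abs_of_nonneg (by positivity : 0 ≤ ‖u‖ ^ (α - n))]
    gcongr
    exact hM u hu

lemma abs_rpow_sub_rpow_le {s m a b : ℝ} (hs : s < 0) (hm : 0 < m) (ha : m ≤ a) (hb : m ≤ b) :
    |a ^ s - b ^ s| ≤ -s * m ^ (s - 1) * |a - b| := by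
  refine Convex.norm_image_sub_le_of_norm_deriv_le (f := fun t : ℝ => t ^ s)
    (s := Set.Ici m) (C := -s * m ^ (s - 1)) (fun t ht => ?_) (fun t ht => ?_)
    (convex_Ici m) hb ha
  · exact Real.differentiableAt_rpow_const_of_ne _ (hm.trans_le ht).ne'
  · have ht0 : 0 < t := hm.trans_le ht
    rw [Real.deriv_rpow_const, norm_mul, Real.norm_of_nonpos hs.le,
      Real.norm_of_nonneg (by positivity)]
    exact mul_le_mul_of_nonneg_left (Real.rpow_le_rpow_of_nonpos hm ht (by linarith))
      (by linarith)

lemma HomogZero.abs_sub_le (hhom : HomogZero Ω)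
    {L : NNReal} (hlip : LipschitzOnWith L Ω (sphere (0 : EuclideanSpace ℝ (Fin n)) 1))
    {u v : EuclideanSpace ℝ (Fin n)} (hu : u ≠ 0) (hv : v ≠ 0) :
    |Ω u - Ω v| ≤ 2 * L * (‖u - v‖ / ‖u‖) := by
  have hu0 : 0 < ‖u‖ := norm_pos_iff.2 hu
  have hv0 : 0 < ‖v‖ := norm_pos_iff.2 hv
  have h1 := hlip.dist_le_mul _ (normalize_mem_sphere hu) _ (normalize_mem_sphere hv)
  rw [hhom.apply_normalize hu, hhom.apply_normalize hv, Real.dist_eq, dist_eq_norm] at h1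
  have h2 : ‖‖u‖⁻¹ • u - ‖v‖⁻¹ • v‖ ≤ 2 * (‖u - v‖ / ‖u‖) := by
    have e : ‖u‖⁻¹ • u - ‖v‖⁻¹ • v = ‖u‖⁻¹ • (u - v) + (‖u‖⁻¹ - ‖v‖⁻¹) • v := by
      module
    rw [e]
    refine (norm_add_le _ _).trans ?_
    have h3 : ‖(‖u‖⁻¹ - ‖v‖⁻¹) • v‖ = |‖v‖ - ‖u‖| / ‖u‖ := by
      rw [norm_smul, Real.norm_eq_abs, inv_sub_inv hu0.ne' hv0.ne', abs_div,
        abs_of_pos (mul_pos hu0 hv0)]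
      field_simp
    rw [h3, norm_smul, norm_inv, norm_norm]
    have h4 : |‖v‖ - ‖u‖| ≤ ‖u - v‖ := by
      rw [norm_sub_rev]; exact abs_norm_sub_norm_le _ _
    have h5 : |‖v‖ - ‖u‖| / ‖u‖ ≤ ‖u - v‖ / ‖u‖ := by gcongr
    have h6 : ‖u‖⁻¹ * ‖u - v‖ = ‖u - v‖ / ‖u‖ := by ring
    linarith
  calc _ ≤ _ := h1
    _ ≤ L * (2 * (‖u - v‖ / ‖u‖)) := by gcongr
    _ = _ := by ring

/-- Hörmander-type regularity of the kernel. -/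
lemma HomogZero.exists_abs_fracKernel_sub_le (hhom : HomogZero Ω) (hαn : α < n)
    {L : NNReal} (hlip : LipschitzOnWith L Ω (sphere (0 : EuclideanSpace ℝ (Fin n)) 1)) :
    ∃ C > (0 : ℝ), ∀ u v : EuclideanSpace ℝ (Fin n), u ≠ 0 → ‖u - v‖ ≤ ‖u‖ / 2 →
      |fracKernel Ω α u - fracKernel Ω α v| ≤ C * (‖u - v‖ * ‖u‖ ^ (α - n - 1)) := by
  obtain ⟨M, hM0, hM⟩ := hhom.exists_bound hlip
  refine ⟨2 * L + M * ((n - α) * 2⁻¹ ^ (α - n - 1)), ?_, fun u v hu huv => ?_⟩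
  · have : 0 < n - α := by linarith
    positivity
  have hu0 : 0 < ‖u‖ := norm_pos_iff.2 hu
  have hv2 : ‖u‖ * 2⁻¹ ≤ ‖v‖ := by
    have := norm_sub_norm_le u v
    linarith
  have hv : v ≠ 0 := norm_pos_iff.1 (by linarith)
  have e : fracKernel Ω α u - fracKernel Ω α v =
      (Ω u - Ω v) * ‖u‖ ^ (α - n) + Ω v * (‖u‖ ^ (α - n) - ‖v‖ ^ (α - n)) := by
    simp only [fracKernel]; ring
  have h1 : |(Ω u - Ω v) * ‖u‖ ^ (α - n)| ≤ 2 * L * (‖u - v‖ * ‖u‖ ^ (α - n - 1)) := by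
    rw [abs_mul, abs_of_nonneg (by positivity : 0 ≤ ‖u‖ ^ (α - n)), Real.rpow_sub_one hu0.ne']
    calc _ ≤ 2 * L * (‖u - v‖ / ‖u‖) * ‖u‖ ^ (α - n) := by
          gcongr; exact hhom.abs_sub_le hlip hu hv
      _ = _ := by ring
  have h2 : |Ω v * (‖u‖ ^ (α - n) - ‖v‖ ^ (α - n))| ≤
      M * ((n - α) * 2⁻¹ ^ (α - n - 1)) * (‖u - v‖ * ‖u‖ ^ (α - n - 1)) := by
    rw [abs_mul]
    have h3 := abs_rpow_sub_rpow_le (s := α - n) (m := ‖u‖ * 2⁻¹) (a := ‖u‖) (by linarith)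
      (by positivity) (by linarith) hv2
    rw [Real.mul_rpow (by positivity) (by positivity)] at h3
    have h4 : |‖u‖ - ‖v‖| ≤ ‖u - v‖ := abs_norm_sub_norm_le _ _
    have : 0 < n - α := by linarith
    calc _ ≤ M * (-(α - n) * (‖u‖ ^ (α - n - 1) * 2⁻¹ ^ (α - n - 1)) * |‖u‖ - ‖v‖|) := by
          gcongr; exact hM v hv
      _ ≤ M * (-(α - n) * (‖u‖ ^ (α - n - 1) * 2⁻¹ ^ (α - n - 1)) * ‖u - v‖) := by
          have : 0 < -(α - n) := by linarith
          gcongr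
      _ = _ := by ring
  rw [e, add_mul]
  exact (abs_add_le _ _).trans (add_le_add h1 h2)

end Kernel

lemma closedBall_subset_cube {n : ℕ} (c : EuclideanSpace ℝ (Fin n)) (ρ : ℝ) :
    closedBall c ρ ⊆ cube c (2 * ρ) := fun y hy =>
  mem_cube_of_norm_le (by rw [← dist_eq_norm]; simpa using hy)

lemma lintegral_cube_lintegral_closedBall_le {n : ℕ} (hn : 1 ≤ n) {α : ℝ} (hα : 0 < α)
    (hαn : α < n) :
    ∃ C > (0 : ℝ), ∀ (c : EuclideanSpace ℝ (Fin n)) (r : ℝ), 0 < r →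
      ∀ g : EuclideanSpace ℝ (Fin n) → ℝ≥0∞, Measurable g →
      ∫⁻ y in cube c r, ∫⁻ z in closedBall c (n * r), ENNReal.ofReal (‖y - z‖ ^ (α - n)) * g z ≤
        ENNReal.ofReal (C * r ^ α) * ∫⁻ z in closedBall c (n * r), g z := by
  obtain ⟨C, hC, h⟩ := lintegral_closedBall_norm_rpow_le hα hαn
  have hn0 : (0 : ℝ) < n := by exact_mod_cast hn
  refine ⟨C * (2 * n) ^ α, by positivity, fun c r hr g hg => ?_⟩
  have hm : Measurable (fun q : EuclideanSpace ℝ (Fin n) × EuclideanSpace ℝ (Fin n) =>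
      ENNReal.ofReal (‖q.1 - q.2‖ ^ (α - n)) * g q.2) := by fun_prop
  rw [lintegral_lintegral_swap hm.aemeasurable,
    ← lintegral_const_mul _ hg]
  refine setLIntegral_mono' measurableSet_closedBall fun z hz => ?_
  rw [lintegral_mul_const _ (by fun_prop)]
  gcongr
  have hsub : cube c r ⊆ closedBall z (2 * n * r) := fun y hy => by
    have h1 := norm_le_of_mem_cube hr hy
    have h2 : dist z c ≤ n * r := hz
    have h3 := dist_triangle y c z
    rw [dist_comm c z, dist_eq_norm y c] at h3
    have : 0 < n * r := by positivity
    simp only [mem_closedBall]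
    linarith
  refine (lintegral_mono_set hsub).trans ((h z (2 * n * r) (by positivity)).trans (le_of_eq ?_))
  rw [Real.mul_rpow (by positivity) hr.le, mul_assoc]

section Local

variable {n : ℕ} {Ω : EuclideanSpace ℝ (Fin n) → ℝ} {α : ℝ}

lemma half_norm_le_norm_sub {c y z : EuclideanSpace ℝ (Fin n)} {r : ℝ} (hr : 0 < r)
    (hy : y ∈ cube c r) (hz : z ∈ (closedBall c (n * r))ᶜ) :
    ‖(c - z) - (y - z)‖ ≤ ‖c - z‖ / 2 ∧ ‖z - c‖ * 2⁻¹ ≤ ‖y - z‖ := by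
  have h1 := norm_le_of_mem_cube hr hy
  have h2 : n * r < ‖z - c‖ := by simpa [dist_eq_norm] using hz
  have h3 : ‖z - c‖ ≤ ‖y - c‖ + ‖y - z‖ := by
    have := norm_sub_le (y - c) (y - z)
    rwa [show (y - c) - (y - z) = z - c by abel] at this
  rw [show (c - z) - (y - z) = c - y by abel, norm_sub_rev c y, norm_sub_rev c z]
  constructor <;> linarith

lemma integrableOn_fracKernel_compl_closedBall (hn : 1 ≤ n) (hαn : α < n)
    (hK : Measurable (fracKernel Ω α)) {M : ℝ} (hM : ∀ u, u ≠ 0 → |Ω u| ≤ M)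
    {w : EuclideanSpace ℝ (Fin n) → ℝ} (hw : Measurable w)
    {c : EuclideanSpace ℝ (Fin n)} {r : ℝ} (hr : 0 < r) {A : ℝ≥0∞} (hA : A ≠ ∞) {δ : ℝ}
    (hδ : 0 < δ)
    (h : ∀ t, n * r ≤ t →
      ∫⁻ z in cube c t, ENNReal.ofReal |w z| ≤ A * ENNReal.ofReal (t ^ (n - α - δ)))
    {y : EuclideanSpace ℝ (Fin n)} (hy : y ∈ cube c r) :
    IntegrableOn (fun z => fracKernel Ω α (y - z) * w z) (closedBall c (n * r))ᶜ := by
  have hn0 : (0 : ℝ) < n := by exact_mod_cast hn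
  obtain ⟨C, hC, hfar⟩ := lintegral_compl_closedBall_le n (s := n - α) (by linarith) hδ
  have h1 := hfar c (n * r) (by positivity) (fun z => ENNReal.ofReal |w z|) (by fun_prop) A h
  refine ⟨((hK.comp (measurable_const.sub measurable_id)).mul hw).aestronglyMeasurable, ?_⟩
  have hpt : ∀ z ∈ (closedBall c (n * r))ᶜ, ‖fracKernel Ω α (y - z) * w z‖ₑ ≤
      ENNReal.ofReal (M * 2⁻¹ ^ (α - n)) *
        (ENNReal.ofReal (‖z - c‖ ^ (-(n - α))) * ENNReal.ofReal |w z|) := by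
    intro z hz
    have hz2 : n * r < ‖z - c‖ := by simpa [dist_eq_norm] using hz
    have hz0 : 0 < ‖z - c‖ := lt_of_le_of_lt (by positivity) hz2
    have hM0 : 0 ≤ M := (abs_nonneg _).trans (hM _ (norm_pos_iff.1 hz0))
    rw [Real.enorm_eq_ofReal_abs, abs_mul, ← ENNReal.ofReal_mul (by positivity),
      ← ENNReal.ofReal_mul (by positivity), neg_sub]
    refine ENNReal.ofReal_le_ofReal ?_
    calc _ ≤ (M * ‖y - z‖ ^ (α - n)) * |w z| := by
          gcongr; exact abs_fracKernel_le hαn hM _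
      _ ≤ (M * (‖z - c‖ * 2⁻¹) ^ (α - n)) * |w z| := by
          gcongr ?_ * _
          refine mul_le_mul_of_nonneg_left ?_ hM0
          exact Real.rpow_le_rpow_of_nonpos (by positivity) (half_norm_le_norm_sub hr hy hz).2
            (by linarith)
      _ = _ := by rw [Real.mul_rpow (by positivity) (by positivity)]; ring
  refine (setLIntegral_mono' measurableSet_closedBall.compl hpt).trans_lt ?_
  rw [lintegral_const_mul _ (by fun_prop)]
  exact ENNReal.mul_lt_top ofReal_lt_top
    (h1.trans_lt (ENNReal.mul_lt_top ofReal_lt_top hA.lt_top))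

lemma lintegral_enorm_fracKernel_mul_le (hαn : α < n) {M : ℝ}
    (hM0 : 0 ≤ M) (hM : ∀ u, u ≠ 0 → |Ω u| ≤ M)
    {w : EuclideanSpace ℝ (Fin n) → ℝ} (hw : Measurable w) (B : Set (EuclideanSpace ℝ (Fin n)))
    (y : EuclideanSpace ℝ (Fin n)) :
    ∫⁻ z in B, ‖fracKernel Ω α (y - z) * w z‖ₑ ≤
      ENNReal.ofReal M *
        ∫⁻ z in B, ENNReal.ofReal (‖y - z‖ ^ (α - n)) * ENNReal.ofReal |w z| := by
  rw [← lintegral_const_mul _ (by fun_prop)]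
  refine lintegral_mono fun z => ?_
  rw [Real.enorm_eq_ofReal_abs, abs_mul, ← ENNReal.ofReal_mul (by positivity),
      ← ENNReal.ofReal_mul hM0, ← mul_assoc]
  refine ENNReal.ofReal_le_ofReal ?_
  gcongr
  exact abs_fracKernel_le hαn hM _

lemma ae_integrable_fracKernel (hn : 1 ≤ n) (hα : 0 < α) (hαn : α < n)
    (hK : Measurable (fracKernel Ω α)) {M : ℝ} (hM0 : 0 ≤ M) (hM : ∀ u, u ≠ 0 → |Ω u| ≤ M)
    {w : EuclideanSpace ℝ (Fin n) → ℝ} (hw : Measurable w)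
    {c : EuclideanSpace ℝ (Fin n)} {r : ℝ} (hr : 0 < r) {A : ℝ≥0∞} (hA : A ≠ ∞) {δ : ℝ}
    (hδ : 0 < δ)
    (h : ∀ t, n * r ≤ t →
      ∫⁻ z in cube c t, ENNReal.ofReal |w z| ≤ A * ENNReal.ofReal (t ^ (n - α - δ))) :
    ∀ᵐ y ∂(volume.restrict (cube c r)), Integrable (fun z => fracKernel Ω α (y - z) * w z) := by
  have hn0 : (0 : ℝ) < n := by exact_mod_cast hn
  obtain ⟨C, hC, hnear⟩ := lintegral_cube_lintegral_closedBall_le hn hα hαn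
  have h1 := hnear c r hr (fun z => ENNReal.ofReal |w z|) (by fun_prop)
  have h2 : ∫⁻ z in closedBall c (n * r), ENNReal.ofReal |w z| < ∞ :=
    (lintegral_mono_set (closedBall_subset_cube c _)).trans_lt
      ((h (2 * (n * r)) (by nlinarith)).trans_lt (ENNReal.mul_lt_top hA.lt_top ofReal_lt_top))
  have hm : Measurable (fun q : EuclideanSpace ℝ (Fin n) × EuclideanSpace ℝ (Fin n) =>
      ENNReal.ofReal (‖q.1 - q.2‖ ^ (α - n)) * ENNReal.ofReal |w q.2|) := by fun_prop
  have h3 := ae_lt_top hm.lintegral_prod_right'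
    (h1.trans_lt (ENNReal.mul_lt_top ofReal_lt_top h2)).ne
  filter_upwards [h3, ae_restrict_mem (measurableSet_cube c r)] with y hy3 hy
  rw [← integrableOn_univ, ← Set.union_compl_self (closedBall c (n * r))]
  refine IntegrableOn.union ⟨((hK.comp (measurable_const.sub measurable_id)).mul
    hw).aestronglyMeasurable, ?_⟩
    (integrableOn_fracKernel_compl_closedBall hn hαn hK hM hw hr hA hδ h hy)
  exact (lintegral_enorm_fracKernel_mul_le hαn hM0 hM hw _ y).trans_lt
    (ENNReal.mul_lt_top ofReal_lt_top hy3)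

lemma measurable_fracInt (hK : Measurable (fracKernel Ω α))
    {f : EuclideanSpace ℝ (Fin n) → ℝ} (hf : Measurable f) : Measurable (fracInt Ω α f) := by
  have : StronglyMeasurable (Function.uncurry fun x y : EuclideanSpace ℝ (Fin n) =>
      fracKernel Ω α (x - y) * f y) :=
    Measurable.stronglyMeasurable
      ((hK.comp (measurable_fst.sub measurable_snd)).mul (hf.comp measurable_snd))
  exact this.integral_prod_right.measurable

end Local

section Lip

variable {n : ℕ} {β : ℝ} {b : EuclideanSpace ℝ (Fin n) → ℝ}

lemma MemLip.abs_sub_le_lipNorm (hβ : 0 < β) (hb : MemLip β b) (x y : EuclideanSpace ℝ (Fin n)) :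
    |b x - b y| ≤ lipNorm β b * dist x y ^ β := by
  rcases eq_or_ne x y with rfl | hxy
  · simp [Real.zero_rpow hβ.ne']
  · have hd : 0 < dist x y ^ β := Real.rpow_pos_of_pos (dist_pos.2 hxy) _
    rw [← div_le_iff₀ hd]
    exact le_csInf hb fun C hC => (div_le_iff₀ hd).2 (hC x y)

lemma lipNorm_nonneg (hn : 1 ≤ n) : 0 ≤ lipNorm β b := by
  refine Real.sInf_nonneg fun C hC => ?_
  have : Nonempty (Fin n) := ⟨⟨0, hn⟩⟩
  obtain ⟨x, y, hxy⟩ := exists_pair_ne (EuclideanSpace ℝ (Fin n))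
  have hd : 0 < dist x y ^ β := Real.rpow_pos_of_pos (dist_pos.2 hxy) _
  exact nonneg_of_mul_nonneg_left ((abs_nonneg _).trans (hC x y)) hd

lemma continuous_of_mem_lipConstSet (hβ : 0 < β) {C : ℝ} (hb : C ∈ LipConstSet β b) :
    Continuous b := by
  rw [continuous_iff_continuousAt]
  intro x
  rw [ContinuousAt, tendsto_iff_dist_tendsto_zero]
  refine squeeze_zero (fun _ => dist_nonneg) (fun y => hb y x) ?_
  have : Continuous fun y : EuclideanSpace ℝ (Fin n) => C * dist y x ^ β := by
    exact continuous_const.mul ((continuous_id.dist continuous_const).rpow_const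
      fun _ => Or.inr hβ.le)
  simpa [Real.zero_rpow hβ.ne'] using this.tendsto x

lemma abs_sub_le_of_mem_cube (hβ : 0 < β) {C : ℝ} (hC : 0 ≤ C) (hb : C ∈ LipConstSet β b)
    {c y : EuclideanSpace ℝ (Fin n)} {t : ℝ} (ht : 0 < t) (hy : y ∈ cube c t) :
    |b y - b c| ≤ C * (n / 2) ^ β * t ^ β := by
  refine (hb y c).trans ?_
  rw [mul_assoc, ← Real.mul_rpow (by positivity) ht.le, dist_eq_norm]
  have := norm_le_of_mem_cube ht hy
  gcongr
  linarith

lemma setLIntegral_cube_sub_mul_le (hβ : 0 < β) {C : ℝ} (hC : 0 ≤ C) (hb : C ∈ LipConstSet β b)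
    {f : EuclideanSpace ℝ (Fin n) → ℝ} (hf : Measurable f)
    (c : EuclideanSpace ℝ (Fin n)) {t : ℝ} (ht : 0 < t) {A : ℝ≥0∞} {s : ℝ}
    (h : ∫⁻ z in cube c t, ENNReal.ofReal |f z| ≤ A * ENNReal.ofReal (t ^ s)) :
    ∫⁻ z in cube c t, ENNReal.ofReal |(b z - b c) * f z| ≤
      (ENNReal.ofReal (C * (n / 2) ^ β) * A) * ENNReal.ofReal (t ^ (s + β)) := by
  calc _ ≤ ∫⁻ z in cube c t, ENNReal.ofReal (C * (n / 2) ^ β * t ^ β) * ENNReal.ofReal |f z| := by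
        refine setLIntegral_mono' (measurableSet_cube c t) fun z hz => ?_
        rw [abs_mul, ENNReal.ofReal_mul (abs_nonneg _)]
        gcongr
        exact abs_sub_le_of_mem_cube hβ hC hb ht hz
    _ ≤ ENNReal.ofReal (C * (n / 2) ^ β * t ^ β) * (A * ENNReal.ofReal (t ^ s)) := by
        rw [lintegral_const_mul _ (by fun_prop)]
        gcongr
    _ = _ := by
        rw [ENNReal.ofReal_mul (p := C * (n / 2) ^ β) (by positivity), Real.rpow_add ht,
          ENNReal.ofReal_mul (p := t ^ s) (by positivity)]
        ring

end Lip

lemma commutatorOp_eq {n : ℕ} {Ω : EuclideanSpace ℝ (Fin n) → ℝ} {α : ℝ}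
    {b f : EuclideanSpace ℝ (Fin n) → ℝ} (b₀ : ℝ) {y : EuclideanSpace ℝ (Fin n)}
    (hf : Integrable fun z => fracKernel Ω α (y - z) * f z)
    (hbf : Integrable fun z => fracKernel Ω α (y - z) * ((b z - b₀) * f z)) :
    commutatorOp Ω α b f y =
      (b y - b₀) * fracInt Ω α f y - ∫ z, fracKernel Ω α (y - z) * ((b z - b₀) * f z) := by
  have h : fracInt Ω α (fun z => b z * f z) y =
      b₀ * fracInt Ω α f y + ∫ z, fracKernel Ω α (y - z) * ((b z - b₀) * f z) := by
    simp only [fracInt]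
    change _ = b₀ * (∫ z, fracKernel Ω α (y - z) * f z) + _
    rw [← integral_const_mul, ← integral_add (hf.const_mul b₀) hbf]
    refine integral_congr_ae (.of_forall fun z => ?_)
    simp only [fracKernel]
    ring
  rw [commutatorOp, h]
  ring

/-- Splitting `w` into a part near `c` and a part away from `c`, the function
`y ↦ ∫ K(y - z) w(z) dz` is close on the cube `cube c r` to the constant given by the value at
`c` of the contribution away from `c`. -/
lemma enorm_integral_fracKernel_sub_le {n : ℕ} {Ω : EuclideanSpace ℝ (Fin n) → ℝ} {α : ℝ}
    (hn : 1 ≤ n) (hαn : α < n) {M : ℝ} (hM0 : 0 ≤ M) (hM : ∀ u, u ≠ 0 → |Ω u| ≤ M)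
    {D : ℝ} (hD0 : 0 ≤ D)
    (hD : ∀ u v : EuclideanSpace ℝ (Fin n), u ≠ 0 → ‖u - v‖ ≤ ‖u‖ / 2 →
      |fracKernel Ω α u - fracKernel Ω α v| ≤ D * (‖u - v‖ * ‖u‖ ^ (α - n - 1)))
    {w : EuclideanSpace ℝ (Fin n) → ℝ} (hw : Measurable w)
    {c y : EuclideanSpace ℝ (Fin n)} {r : ℝ} (hr : 0 < r) (hy : y ∈ cube c r)
    (hwy : Integrable fun z => fracKernel Ω α (y - z) * w z)
    (hwc : IntegrableOn (fun z => fracKernel Ω α (c - z) * w z) (closedBall c (n * r))ᶜ) :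
    ‖(∫ z, fracKernel Ω α (y - z) * w z) -
        ∫ z in (closedBall c (n * r))ᶜ, fracKernel Ω α (c - z) * w z‖ₑ ≤
      ENNReal.ofReal M * (∫⁻ z in closedBall c (n * r),
          ENNReal.ofReal (‖y - z‖ ^ (α - n)) * ENNReal.ofReal |w z|) +
        ENNReal.ofReal (D * (n * r)) * ∫⁻ z in (closedBall c (n * r))ᶜ,
          ENNReal.ofReal (‖z - c‖ ^ (-(n + 1 - α))) * ENNReal.ofReal |w z| := by
  have hn0 : (0 : ℝ) < n := by exact_mod_cast hn
  rw [← integral_add_compl measurableSet_closedBall hwy, add_sub_assoc,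
    ← integral_sub hwy.integrableOn hwc]
  refine (enorm_add_le _ _).trans (add_le_add ?_ ?_)
  · exact (enorm_integral_le_lintegral_enorm _).trans
      (lintegral_enorm_fracKernel_mul_le hαn hM0 hM hw _ y)
  · rw [← lintegral_const_mul _ (by fun_prop)]
    refine (enorm_integral_le_lintegral_enorm _).trans
      (setLIntegral_mono' measurableSet_closedBall.compl fun z hz => ?_)
    have hz2 : n * r < ‖z - c‖ := by simpa [dist_eq_norm] using hz
    have hz0 : 0 < ‖z - c‖ := lt_of_le_of_lt (by positivity) hz2
    have hcz : c - z ≠ 0 := by rw [← norm_pos_iff, norm_sub_rev]; exact hz0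
    have h1 := hD (c - z) (y - z) hcz (half_norm_le_norm_sub hr hy hz).1
    have h2 : ‖(c - z) - (y - z)‖ ≤ n * r := by
      rw [show (c - z) - (y - z) = c - y by abel, norm_sub_rev]
      have := norm_le_of_mem_cube hr hy
      have : 0 < n * r := by positivity
      linarith
    rw [← sub_mul, Real.enorm_eq_ofReal_abs, abs_mul, abs_sub_comm,
      ← ENNReal.ofReal_mul (by positivity), ← ENNReal.ofReal_mul (by positivity), ← mul_assoc]
    refine ENNReal.ofReal_le_ofReal (mul_le_mul_of_nonneg_right ?_ (abs_nonneg _))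
    calc _ ≤ _ := h1
      _ ≤ D * ((n * r) * ‖c - z‖ ^ (α - n - 1)) := by gcongr
      _ = _ := by
        rw [norm_sub_rev, show α - n - 1 = -(n + 1 - α) by ring]
        ring

/-- The oscillation of the commutator on a cube around a suitable constant. -/
lemma exists_lintegral_cube_commutatorOp_sub_le {n : ℕ} (hn : 1 ≤ n) {α β p η : ℝ} (hα0 : 0 < α)
    (hαn : α < n) (hβ0 : 0 < β) (hαβ : α + β < n)
    (hp1 : 1 < p) (hp : p < n / (α + β)) (hη1 : 1 < η)
    {Ω : EuclideanSpace ℝ (Fin n) → ℝ} (hhom : HomogZero Ω)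
    {L : NNReal} (hlip : LipschitzOnWith L Ω (sphere (0 : EuclideanSpace ℝ (Fin n)) 1)) :
    ∃ C > (0 : ℝ), ∀ (b : EuclideanSpace ℝ (Fin n) → ℝ) (Λ : ℝ), 0 ≤ Λ → Λ ∈ LipConstSet β b →
      ∀ f : EuclideanSpace ℝ (Fin n) → ℝ, Measurable f → _root_.lpNorm p f ≠ ∞ →
      ∀ (x c : EuclideanSpace ℝ (Fin n)) (r : ℝ), 0 < r → x ∈ cube c r → ∃ a : ℝ,
        ∫⁻ y in cube c r, ENNReal.ofReal |commutatorOp Ω α b f y - a| ≤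
          ENNReal.ofReal (r ^ (n : ℝ)) * (ENNReal.ofReal (C * Λ) *
            ((fracMax (β * η) (fun y => |fracInt Ω α f y| ^ η) x) ^ (1 / η) +
              (fracMax ((α + β) * η) (fun y => |f y| ^ η) x) ^ (1 / η))) := by
  have hn0 : (0 : ℝ) < n := by exact_mod_cast hn
  have hp0 : 0 < p := by linarith
  have hδ : α + β < n / p := by
    rw [lt_div_iff₀ (by linarith)] at hp
    rw [lt_div_iff₀ hp0]; linarith
  obtain ⟨M, hM0, hM⟩ := hhom.exists_bound hlip
  obtain ⟨D, hD0, hD⟩ := hhom.exists_abs_fracKernel_sub_le hαn hlip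
  obtain ⟨N, hN0, hnear⟩ := lintegral_cube_lintegral_closedBall_le hn hα0 hαn
  obtain ⟨S, hS0, hfar⟩ := lintegral_compl_closedBall_le n (s := n + 1 - α) (δ := 1)
    (by linarith) one_pos
  have hK : Measurable (fracKernel Ω α) := hhom.measurable_fracKernel hlip
  set κ : ℝ := (n / 2 : ℝ) ^ β with hκ
  have hκ0 : 0 < κ := by positivity
  refine ⟨κ + M * N * (2 * n) ^ (n - α) * κ + D * S * κ, by positivity,
    fun b Λ hΛ hb f hf hfp x c r hr hx => ?_⟩
  have hbm : Measurable b := (continuous_of_mem_lipConstSet hβ0 hb).measurable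
  set w : EuclideanSpace ℝ (Fin n) → ℝ := fun z => (b z - b c) * f z with hw_def
  have hw : Measurable w := (hbm.sub_const _).mul hf
  set B := closedBall c (n * r) with hB
  have hρ : 0 < n * r := by positivity
  have hrn : r ≤ n * r := by
    have : (1 : ℝ) ≤ n := by exact_mod_cast hn
    nlinarith
  set G₁ := (fracMax (β * η) (fun y => |fracInt Ω α f y| ^ η) x) ^ (1 / η)
  set G₂ := (fracMax ((α + β) * η) (fun y => |f y| ^ η) x) ^ (1 / η)
  have hT : Measurable (fracInt Ω α f) := measurable_fracInt hK hf
  have hfint : ∀ᵐ y ∂(volume.restrict (cube c r)),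
      Integrable (fun z => fracKernel Ω α (y - z) * f z) := by
    refine ae_integrable_fracKernel hn hα0 hαn hK hM0.le hM hf hr hfp (δ := n / p - α)
      (by linarith) fun t ht => ?_
    convert setLIntegral_cube_le_lpNorm hp1 hf c (hρ.trans_le ht) using 4
    ring
  have hwgrowth : ∀ t, n * r ≤ t → ∫⁻ z in cube c t, ENNReal.ofReal |w z| ≤
      (ENNReal.ofReal (Λ * κ) * _root_.lpNorm p f) *
        ENNReal.ofReal (t ^ (n - α - (n / p - (α + β)))) := fun t ht => by
    convert setLIntegral_cube_sub_mul_le hβ0 hΛ hb hf c (hρ.trans_le ht)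
      (setLIntegral_cube_le_lpNorm hp1 hf c (hρ.trans_le ht)) using 4
    ring
  have hAw : ENNReal.ofReal (Λ * κ) * _root_.lpNorm p f ≠ ∞ := ENNReal.mul_ne_top ofReal_ne_top hfp
  have hwint := ae_integrable_fracKernel hn hα0 hαn hK hM0.le hM hw hr hAw
    (by linarith) hwgrowth
  have hcc : c ∈ cube c r := mem_cube_of_norm_le (by simp; positivity)
  have hwc := integrableOn_fracKernel_compl_closedBall hn hαn hK hM hw hr hAw
    (by linarith) hwgrowth hcc
  have hwG : ∀ t, n * r ≤ t → ∫⁻ z in cube c t, ENNReal.ofReal |w z| ≤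
      (ENNReal.ofReal (Λ * κ) * G₂) * ENNReal.ofReal (t ^ (n - α)) := fun t ht => by
    convert setLIntegral_cube_sub_mul_le hβ0 hΛ hb hf c (hρ.trans_le ht)
      (setLIntegral_cube_le_fracMax hn hη1 (α + β) hf (hρ.trans_le ht)
        (cube_mono c (hrn.trans ht) hx)) using 4
    ring
  have hfarw := hfar c (n * r) hρ (fun z => ENNReal.ofReal |w z|) (by fun_prop)
    (ENNReal.ofReal (Λ * κ) * G₂) fun t ht => by
      convert hwG t ht using 4
      ring
  set I₃ := ∫⁻ z in Bᶜ, ENNReal.ofReal (‖z - c‖ ^ (-(n + 1 - α))) * ENNReal.ofReal |w z|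
  set I₂ : EuclideanSpace ℝ (Fin n) → ℝ≥0∞ := fun y =>
    ∫⁻ z in B, ENNReal.ofReal (‖y - z‖ ^ (α - n)) * ENNReal.ofReal |w z|
  have hI₂ : Measurable I₂ := by
    have hm : Measurable (fun q : EuclideanSpace ℝ (Fin n) × EuclideanSpace ℝ (Fin n) =>
      ENNReal.ofReal (‖q.1 - q.2‖ ^ (α - n)) * ENNReal.ofReal |w q.2|) := by fun_prop
    exact hm.lintegral_prod_right'
  refine ⟨-∫ z in Bᶜ, fracKernel Ω α (c - z) * w z, ?_⟩
  have hpt : ∀ᵐ y ∂(volume.restrict (cube c r)),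
      ENNReal.ofReal |commutatorOp Ω α b f y - -∫ z in Bᶜ, fracKernel Ω α (c - z) * w z| ≤
        ENNReal.ofReal (Λ * κ * r ^ β) * ENNReal.ofReal |fracInt Ω α f y| +
          (ENNReal.ofReal M * I₂ y + ENNReal.ofReal (D * (n * r)) * I₃) := by
    filter_upwards [hfint, hwint, ae_restrict_mem (measurableSet_cube c r)] with y hy1 hy2 hy
    rw [commutatorOp_eq (b c) hy1 hy2, sub_neg_eq_add, ← Real.enorm_eq_ofReal_abs, sub_add]
    refine (enorm_sub_le).trans (add_le_add ?_
      (enorm_integral_fracKernel_sub_le hn hαn hM0.le hM hD0.le hD hw hr hy hy2 hwc))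
    rw [enorm_mul, Real.enorm_eq_ofReal_abs, Real.enorm_eq_ofReal_abs]
    gcongr
    exact abs_sub_le_of_mem_cube hβ0 hΛ hb hr hy
  have h₁ : ∫⁻ y in cube c r, ENNReal.ofReal |fracInt Ω α f y| ≤
      G₁ * ENNReal.ofReal (r ^ (n - β)) :=
    setLIntegral_cube_le_fracMax hn hη1 β hT hr hx
  have h₂ : ∫⁻ y in cube c r, I₂ y ≤ ENNReal.ofReal (N * r ^ α) *
      ((ENNReal.ofReal (Λ * κ) * G₂) * ENNReal.ofReal ((2 * (n * r)) ^ (n - α))) := by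
    refine (hnear c r hr _ (by fun_prop)).trans (mul_le_mul_right ?_ _)
    exact (lintegral_mono_set (closedBall_subset_cube c _)).trans (hwG _ (by linarith))
  calc _ ≤ _ := lintegral_mono_ae hpt
    _ = ENNReal.ofReal (Λ * κ * r ^ β) * (∫⁻ y in cube c r, ENNReal.ofReal |fracInt Ω α f y|) +
          (ENNReal.ofReal M * (∫⁻ y in cube c r, I₂ y) +
            ENNReal.ofReal (D * (n * r)) * I₃ * ENNReal.ofReal (r ^ (n : ℝ))) := by
        rw [lintegral_add_left (by fun_prop), lintegral_const_mul _ (by fun_prop),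
          lintegral_add_left (by fun_prop), lintegral_const_mul _ hI₂, lintegral_const,
          Measure.restrict_apply_univ, volume_cube c hr]
    _ ≤ ENNReal.ofReal (Λ * κ * r ^ β) * (G₁ * ENNReal.ofReal (r ^ (n - β))) +
          (ENNReal.ofReal M * (ENNReal.ofReal (N * r ^ α) *
            ((ENNReal.ofReal (Λ * κ) * G₂) * ENNReal.ofReal ((2 * (n * r)) ^ (n - α)))) +
          ENNReal.ofReal (D * (n * r)) * (ENNReal.ofReal (S * (n * r) ^ (-1 : ℝ)) *
            (ENNReal.ofReal (Λ * κ) * G₂)) * ENNReal.ofReal (r ^ (n : ℝ))) := by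
        gcongr
    _ = ENNReal.ofReal (r ^ (n : ℝ)) * (ENNReal.ofReal (κ * Λ) * G₁ +
          ENNReal.ofReal ((M * N * (2 * n) ^ (n - α) * κ + D * S * κ) * Λ) * G₂) := by
        have e1 : ENNReal.ofReal (Λ * κ * r ^ β) * (G₁ * ENNReal.ofReal (r ^ (n - β))) =
            ENNReal.ofReal (r ^ (n : ℝ)) * ENNReal.ofReal (κ * Λ) * G₁ := by
          rw [mul_left_comm, ← ENNReal.ofReal_mul (by positivity),
            ← ENNReal.ofReal_mul (by positivity), mul_comm]
          congr 2
          rw [mul_assoc, ← Real.rpow_add hr]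
          ring_nf
        have e2 : ENNReal.ofReal M * (ENNReal.ofReal (N * r ^ α) *
            ((ENNReal.ofReal (Λ * κ) * G₂) * ENNReal.ofReal ((2 * (n * r)) ^ (n - α)))) =
            ENNReal.ofReal (r ^ (n : ℝ)) *
              ENNReal.ofReal (M * N * (2 * n) ^ (n - α) * κ * Λ) * G₂ := by
          rw [mul_right_comm _ G₂, ← mul_assoc, ← mul_assoc,
            ← ENNReal.ofReal_mul (by positivity), ← ENNReal.ofReal_mul (by positivity),
            ← ENNReal.ofReal_mul (by positivity), ← ENNReal.ofReal_mul (by positivity)]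
          congr 2
          rw [← mul_assoc 2, Real.mul_rpow (by positivity) hr.le]
          have : r ^ (n : ℝ) = r ^ α * r ^ (n - α) := by
            rw [← Real.rpow_add hr]; ring_nf
          rw [this]; ring
        have e3 : ENNReal.ofReal (D * (n * r)) * (ENNReal.ofReal (S * (n * r) ^ (-1 : ℝ)) *
            (ENNReal.ofReal (Λ * κ) * G₂)) * ENNReal.ofReal (r ^ (n : ℝ)) =
            ENNReal.ofReal (r ^ (n : ℝ)) * ENNReal.ofReal (D * S * κ * Λ) * G₂ := by
          rw [mul_comm, ← mul_assoc, ← mul_assoc, ← mul_assoc,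
            ← ENNReal.ofReal_mul (by positivity), ← ENNReal.ofReal_mul (by positivity),
            ← ENNReal.ofReal_mul (by positivity), ← ENNReal.ofReal_mul (by positivity)]
          congr 2
          rw [Real.rpow_neg_one]
          field_simp
        rw [e1, e2, e3, add_mul, ENNReal.ofReal_add (by positivity) (by positivity)]
        ring
    _ ≤ ENNReal.ofReal (r ^ (n : ℝ)) *
          (ENNReal.ofReal ((κ + M * N * (2 * n) ^ (n - α) * κ + D * S * κ) * Λ) * G₁ +
          ENNReal.ofReal ((κ + M * N * (2 * n) ^ (n - α) * κ + D * S * κ) * Λ) * G₂) := by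
        have : 0 < M * N * (2 * n) ^ (n - α) * κ := by positivity
        have : 0 < D * S * κ := by positivity
        gcongr <;> linarith
    _ = _ := by rw [← mul_add]

theorem statement10 (n : ℕ) (hn : 1 ≤ n) (α β p q η : ℝ) (hα0 : 0 < α) (hαn : α < n)
    (hβ0 : 0 < β) (hβ1 : β < 1) (hαβ : α + β < n)
    (hp1 : 1 < p) (hp : p < n / (α + β)) (hq : 1 / q = 1 / p - (α + β) / n)
    (hη1 : 1 < η) (hη : η < n / (α + β))
    (Ω : EuclideanSpace ℝ (Fin n) → ℝ) (hhom : HomogZero Ω) (hmean : MeanZeroOnSphere Ω)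
    (L : NNReal) (hlip : LipschitzOnWith L Ω (sphere (0 : EuclideanSpace ℝ (Fin n)) 1)) :
    ∃ C > (0 : ℝ), ∀ b : EuclideanSpace ℝ (Fin n) → ℝ, MemLip β b →
      ∀ f : EuclideanSpace ℝ (Fin n) → ℝ, Measurable f → lpNorm p f ≠ ∞ → ∀ x : EuclideanSpace ℝ (Fin n),
        sharpMax (commutatorOp Ω α b f) x ≤
          ENNReal.ofReal (C * lipNorm β b) *
            ((fracMax (β * η) (fun y => |fracInt Ω α f y| ^ η) x) ^ (1 / η) +
              (fracMax (α * η + β * η) (fun y => |f y| ^ η) x) ^ (1 / η)) := by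
  obtain ⟨C, hC, h⟩ := exists_lintegral_cube_commutatorOp_sub_le hn hα0 hαn hβ0 hαβ hp1 hp hη1
    hhom hlip
  refine ⟨2 * C, by positivity, fun b hb f hf hfp x => ?_⟩
  have hK : Measurable (fracKernel Ω α) := hhom.measurable_fracKernel hlip
  have hbL : lipNorm β b ∈ LipConstSet β b := hb.abs_sub_le_lipNorm hβ0
  have hbm : Measurable b := (continuous_of_mem_lipConstSet hβ0 hbL).measurable
  have hF : Measurable (commutatorOp Ω α b f) :=
    (hbm.mul (measurable_fracInt hK hf)).sub (measurable_fracInt hK (hbm.mul hf))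
  refine iSup₂_le fun c r => iSup₂_le fun hr hx => ?_
  obtain ⟨a, ha⟩ := h b _ (lipNorm_nonneg hn) hbL f hf hfp x c r hr hx
  refine (oscillation_le hF c hr a).trans ?_
  have hrn : 0 < r ^ (n : ℝ) := by positivity
  rw [← add_mul α β η, mul_assoc 2 C, ENNReal.ofReal_mul two_pos.le, ENNReal.ofReal_ofNat,
    mul_assoc 2, volume_cube c hr]
  refine mul_le_mul_right ((mul_le_mul_right ha _).trans (le_of_eq ?_)) 2
  rw [← mul_assoc, ENNReal.inv_mul_cancel (by simpa using hrn) ofReal_ne_top, one_mul]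

end
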